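/- The additive group ℚ cannot be embedded into any finitely generated metabelian group. -/

import Mathlib

theorem Int.isJacobsonRing : IsJacobsonRing ℤ := by
  rw [isJacobsonRing_iff_prime_eq]
  intro P hP
  by_cases h : P = ⊥
  · subst h
    refine le_antisymm (fun x hx ↦ ?_) Ideal.le_jacobson
    have hu := Ideal.mem_jacobson_bot.mp hx (3 * x)
    rw [Ideal.mem_bot]
    rcases Int.isUnit_iff.mp hu with h | h
    · simpa using h
    · nlinarith [mul_self_nonneg x]
  · have := hP.isMaximal h
    exact Ideal.jacobson_eq_self_of_isMaximal

/-- A maximal ideal of a finitely generated commutative ring has positive residue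
characteristic. -/
theorem Ideal.IsMaximal.exists_natCast_mem {R : Type*} [CommRing R] [Algebra.FiniteType ℤ R]
    {m : Ideal R} (hm : m.IsMaximal) : ∃ n : ℕ, n ≠ 0 ∧ (n : R) ∈ m := by
  have := Int.isJacobsonRing
  let := Ideal.Quotient.field m
  have : Algebra.FiniteType ℤ (R ⧸ m) :=
    Algebra.FiniteType.of_surjective (Ideal.Quotient.mkₐ ℤ m) Ideal.Quotient.mk_surjective
  have := finite_of_finite_type_of_isJacobsonRing ℤ (R ⧸ m)
  by_contra! h
  have : CharZero (R ⧸ m) := charZero_of_inj_zero fun n hn ↦ by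
    by_contra h0
    exact h n h0 (Ideal.Quotient.eq_zero_iff_mem.mp (by simpa using hn))
  exact Ideal.IsMaximal.ne_bot_of_isIntegral_int (⊥ : Ideal (R ⧸ m)) rfl

/-- A finitely generated module over a finitely generated commutative ring contains no
nontrivial homomorphic image of `ℚ`. -/
theorem AddMonoidHom.rat_eq_zero_of_finite (R : Type*) {M : Type*} [CommRing R]
    [Algebra.FiniteType ℤ R] [AddCommGroup M] [Module R M] [Module.Finite R M]
    (f : ℚ →+ M) : f = 0 := by
  have : IsNoetherianRing R := Algebra.FiniteType.isNoetherianRing ℤ R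
  ext q
  by_contra hq
  let I := LinearMap.ker (LinearMap.toSpanSingleton R M (f q))
  have hI : I ≠ ⊤ := fun h ↦ hq <| by
    simpa [I] using (Ideal.eq_top_iff_one I).mp h
  obtain ⟨m, hm, hIm⟩ := Ideal.exists_le_maximal I hI
  obtain ⟨n, hn, hnm⟩ := hm.exists_natCast_mem
  have hmem : f q ∈ (⨅ i : ℕ, m ^ i • ⊤ : Submodule R M) := by
    rw [Submodule.mem_iInf]
    intro i
    have : f q = (n : R) ^ i • f (q / n ^ i) := by
      have hdiv : q = n ^ i • (q / n ^ i) := by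
        rw [nsmul_eq_mul]
        push_cast
        field_simp
      conv_lhs => rw [hdiv, map_nsmul, ← Nat.cast_smul_eq_nsmul R, Nat.cast_pow]
    rw [this]
    exact Submodule.smul_mem_smul (Ideal.pow_mem_pow hnm i) trivial
  obtain ⟨r, hr⟩ := (Ideal.mem_iInf_smul_pow_eq_bot_iff m _).mp hmem
  have h1 : 1 - (r : R) ∈ I := by simp [I, sub_smul, hr]
  exact hm.ne_top ((Ideal.eq_top_iff_one m).mpr (by simpa using m.add_mem (hIm h1) r.2))

theorem Algebra.FiniteType.toIntAlgebra {R : Type*} [CommRing R] [inst : Algebra ℤ R]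
    (h : Algebra.FiniteType ℤ R) : @Algebra.FiniteType ℤ R _ _ (Ring.toIntAlgebra R) := by
  rwa [Subsingleton.elim (Ring.toIntAlgebra R) inst]

open scoped commutatorElement

/-- The commutator subgroup is contained in any normal subgroup containing the commutators of
the elements of a generating set. -/
theorem Subgroup.commutator_le_of_closure_eq_top {G : Type*} [Group G] {S : Set G}
    (hS : closure S = ⊤) (N : Subgroup G) [N.Normal] (h : ∀ a ∈ S, ∀ b ∈ S, ⁅a, b⁆ ∈ N) :
    _root_.commutator G ≤ N := by
  have hS' : closure (QuotientGroup.mk' N '' S) = ⊤ := by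
    rw [← MonoidHom.map_closure, hS, ← MonoidHom.range_eq_map,
      MonoidHom.range_eq_top.mpr (QuotientGroup.mk'_surjective N)]
  have hcomm : IsMulCommutative (closure (QuotientGroup.mk' N '' S)) := by
    refine isMulCommutative_closure ?_
    rintro _ ⟨a, ha, rfl⟩ _ ⟨b, hb, rfl⟩
    rw [← commutatorElement_eq_one_iff_mul_comm, ← map_commutatorElement]
    exact (QuotientGroup.eq_one_iff _).mpr (h a ha b hb)
  rw [_root_.commutator_def, commutator_le]
  intro a _ b _
  rw [← QuotientGroup.eq_one_iff, ← QuotientGroup.mk'_apply, map_commutatorElement,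
    commutatorElement_eq_one_iff_mul_comm]
  exact setLike_mul_comm (s := closure (QuotientGroup.mk' N '' S)) (hS' ▸ Subgroup.mem_top _)
    (hS' ▸ Subgroup.mem_top _)

section

open scoped IsMulCommutative

variable (G : Type*) [Group G] [IsMulCommutative (commutator G)]

/-- The representation over `ℤ` of the abelianization of a metabelian group on its commutator
subgroup, induced by conjugation. -/
def commutatorRepresentation :
    Representation ℤ (Abelianization G) (Additive (commutator G)) :=
  QuotientGroup.lift (commutator G)
    { toFun g := (MonoidHom.toAdditive (MulAut.conjNormal g).toMonoidHom).toIntLinearMap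
      map_one' := by ext; simp
      map_mul' a b := by ext; simp }
    fun x hx ↦ by
      ext a
      have := setLike_mul_comm hx a.toMul.2
      simp [this]

theorem commutatorRepresentation_of (g : G) (a : Additive (commutator G)) :
    commutatorRepresentation G (Abelianization.of g) a =
      Additive.ofMul (MulAut.conjNormal g a.toMul) :=
  rfl

theorem commutatorRepresentation_finite [Group.FG G] :
    Module.Finite (MonoidAlgebra ℤ (Abelianization G)) (commutatorRepresentation G).asModule := by
  obtain ⟨S, hS⟩ := Group.fg_def.mp ‹Group.FG G›
  let ρ := commutatorRepresentation G
  let c (p : G × G) : ρ.asModule := ρ.asModuleEquiv.symm <| Additive.ofMul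
    ⟨⁅p.1, p.2⁆, Subgroup.commutator_mem_commutator trivial trivial⟩
  let P := Submodule.span (MonoidAlgebra ℤ (Abelianization G)) (c '' (S ×ˢ S : Set (G × G)))
  let N : Subgroup G :=
    { carrier := {g | ∃ h : g ∈ commutator G, ρ.asModuleEquiv.symm (Additive.ofMul ⟨g, h⟩) ∈ P}
      one_mem' := ⟨one_mem _, P.zero_mem⟩
      mul_mem' := fun ⟨ha, ha'⟩ ⟨hb, hb'⟩ ↦ ⟨mul_mem ha hb, P.add_mem ha' hb'⟩
      inv_mem' := fun ⟨ha, ha'⟩ ↦ ⟨inv_mem ha, P.neg_mem ha'⟩ }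
  have hN : N.Normal := ⟨fun a ⟨ha, ha'⟩ g ↦ ⟨Subgroup.Normal.conj_mem inferInstance a ha g, by
    have := P.smul_mem (MonoidAlgebra.of ℤ _ (Abelianization.of g)) ha'
    rw [← Representation.asModuleEquiv_symm_map_rho, commutatorRepresentation_of] at this
    convert this using 3
    ext
    simp⟩⟩
  have hle : commutator G ≤ N := Subgroup.commutator_le_of_closure_eq_top hS N fun a ha b hb ↦
    ⟨_, Submodule.subset_span ⟨(a, b), ⟨ha, hb⟩, rfl⟩⟩
  have hP : P = ⊤ := by
    rw [eq_top_iff]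
    rintro x -
    exact (hle (ρ.asModuleEquiv x).toMul.2).2
  exact ⟨hP ▸ Submodule.fg_span ((S.finite_toSet.prod S.finite_toSet).image c)⟩

/-- Every homomorphism from `ℚ` to a finitely generated metabelian group is trivial. -/
theorem MonoidHom.rat_eq_one_of_metabelian [Group.FG G] (f : Multiplicative ℚ →* G) : f = 1 := by
  have : Group.FG (Abelianization G) := QuotientGroup.fg _
  have hmem (q : Multiplicative ℚ) : f q ∈ commutator G := by
    have : Module.Finite ℤ (Additive (Abelianization G)) :=
      Module.Finite.iff_addGroup_fg.mpr inferInstance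
    have h := DFunLike.congr_fun (AddMonoidHom.rat_eq_zero_of_finite ℤ
      (MonoidHom.toAdditiveRight (Abelianization.of.comp f))) q
    exact (QuotientGroup.eq_one_iff _).mp h
  have := commutatorRepresentation_finite G
  have : Monoid.FG (Abelianization G) := Group.fg_iff_monoid_fg.mp ‹_›
  have := Algebra.FiniteType.toIntAlgebra (R := MonoidAlgebra ℤ (Abelianization G)) inferInstance
  have h := AddMonoidHom.rat_eq_zero_of_finite (MonoidAlgebra ℤ (Abelianization G))
    ((commutatorRepresentation G).asModuleEquiv.symm.toAddMonoidHom.comp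
      (MonoidHom.toAdditiveRight (f.codRestrict _ hmem)))
  ext q
  exact congrArg Subtype.val (DFunLike.congr_fun h q)

end

/-- The additive group ℚ cannot be embedded into any finitely generated
metabelian group (a group whose derived length is at most 2). -/
theorem q_not_embeddable_in_fg_metabelian (G : Type*) [Group G]
    (hfg : Group.FG G) (hmeta : derivedSeries G 2 = ⊥)
    (f : Multiplicative ℚ →* G) : ¬ Function.Injective f := by
  have : IsMulCommutative (commutator G) := by
    rw [derivedSeries_succ, derivedSeries_one, Subgroup.commutator_eq_bot_iff_le_centralizer]
      at hmeta
    exact .of_setLike_mul_comm fun a ha b hb ↦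
      (Subgroup.mem_centralizer_iff.mp (hmeta ha) b hb).symm
  intro hf
  rw [MonoidHom.rat_eq_one_of_metabelian G f] at hf
  have h : Multiplicative.ofAdd (1 : ℚ) = Multiplicative.ofAdd 0 := hf rfl
  exact one_ne_zero (Multiplicative.ofAdd.injective h)
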